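/- arXiv:1803.04366 — 2 statements merged into one kernel-verified Lean document; each statement's English description precedes it below -/
import Mathlib

section
/- Let X be a real inner product space with inner product ⟪·,·⟫, let Y be a real inner product space and G : X → Y a linear map, let X_h be a finite-dimensional subspace of X on which G is injective, and let V_h be a subspace of X_h. For w ∈ X define ‖w‖_{X_h*} := sup over nonzero v ∈ X_h of ⟪w, v⟫/‖G v‖ and ‖w‖_{V_h*} := sup over nonzero v ∈ V_h of ⟪w, v⟫/‖G v‖. Suppose P : X_h → V_h is a linear map satisfying ⟪P v − v, z⟫ = 0 for all v ∈ X_h and z ∈ V_h, and that there is C_P ≥ 1 with ‖G(P v)‖ ≤ C_P ‖G v‖ for all v ∈ X_h. Then for every w ∈ V_h: C_P^{-1} ‖w‖_{X_h*} ≤ ‖w‖_{V_h*} ≤ ‖w‖_{X_h*}. -/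
open scoped RealInnerProductSpace

/-- The dual norm `‖w‖_{S*} := sup over nonzero v ∈ S of ⟪w, v⟫ / ‖G v‖`. -/
noncomputable def dualNorm {X Y : Type*} [NormedAddCommGroup X] [InnerProductSpace ℝ X]
    [NormedAddCommGroup Y] [InnerProductSpace ℝ Y]
    (G : X →ₗ[ℝ] Y) (S : Set X) (w : X) : ℝ :=
  ⨆ v : {v : X // v ∈ S ∧ v ≠ 0}, ⟪w, (v : X)⟫ / ‖G (v : X)‖

section dualNorm

variable {X Y : Type*} [NormedAddCommGroup X] [InnerProductSpace ℝ X]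
  [NormedAddCommGroup Y] [InnerProductSpace ℝ Y] {G : X →ₗ[ℝ] Y}

theorem dualNorm_nonneg (S : Submodule ℝ X) (w : X) : 0 ≤ dualNorm G (S : Set X) w := by
  rcases isEmpty_or_nonempty {v : X // v ∈ (S : Set X) ∧ v ≠ 0} with h | ⟨v, hv, hv0⟩
  · exact (Real.iSup_of_isEmpty _).ge
  · apply Real.iSup_nonneg'
    rcases le_total 0 ⟪w, v⟫ with h | h
    · exact ⟨⟨v, hv, hv0⟩, div_nonneg h (norm_nonneg _)⟩
    · refine ⟨⟨-v, S.neg_mem hv, neg_ne_zero.mpr hv0⟩, div_nonneg ?_ (norm_nonneg _)⟩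
      simpa [inner_neg_right] using h

theorem dualNorm_le {S : Set X} {w : X} {a : ℝ} (ha : 0 ≤ a)
    (h : ∀ v ∈ S, ⟪w, v⟫ ≤ a * ‖G v‖) : dualNorm G S w ≤ a :=
  Real.iSup_le (fun v ↦ div_le_of_le_mul₀ (norm_nonneg _) ha (h v v.2.1)) ha

/-- On a finite-dimensional subspace where `G` is injective, the supremum defining the dual norm
is over a bounded set, so the duality pairing is controlled by the dual norm. -/
theorem inner_le_dualNorm_mul {S : Submodule ℝ X} [FiniteDimensional ℝ S]
    (hG : ∀ v ∈ S, G v = 0 → v = 0) (w : X) {v : X} (hv : v ∈ S) :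
    ⟪w, v⟫ ≤ dualNorm G (S : Set X) w * ‖G v‖ := by
  rcases eq_or_ne v 0 with rfl | hv0
  · simp
  have hker : LinearMap.ker (G.domRestrict S) = ⊥ :=
    LinearMap.ker_eq_bot'.mpr fun u hu ↦ Subtype.ext (hG u u.2 hu)
  obtain ⟨K, -, hK⟩ := (G.domRestrict S).exists_antilipschitzWith hker
  have hbdd : BddAbove (Set.range fun u : {u : X // u ∈ (S : Set X) ∧ u ≠ 0} ↦
      ⟪w, (u : X)⟫ / ‖G (u : X)‖) := by
    refine ⟨‖w‖ * K, ?_⟩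
    rintro _ ⟨⟨u, hu, hu0⟩, rfl⟩
    refine div_le_of_le_mul₀ (norm_nonneg _) (by positivity) ?_
    have hle : ‖u‖ ≤ K * ‖G u‖ := by
      simpa using hK.le_mul_dist (⟨u, hu⟩ : S) 0
    calc ⟪w, u⟫ ≤ ‖w‖ * ‖u‖ := real_inner_le_norm w u
      _ ≤ ‖w‖ * (K * ‖G u‖) := by gcongr
      _ = ‖w‖ * K * ‖G u‖ := by ring
  have hGv : 0 < ‖G v‖ := norm_pos_iff.mpr fun h ↦ hv0 (hG v hv h)
  exact (div_le_iff₀ hGv).mp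
    (le_ciSup hbdd (⟨v, hv, hv0⟩ : {u : X // u ∈ (S : Set X) ∧ u ≠ 0}))

end dualNorm

/-- Lemma 2.3 (abstract form): equivalence of the dual norms `‖·‖_{X_h*}` and `‖·‖_{V_h*}`
on `V_h`, given an orthogonal projection `P : X_h → V_h` that is stable with respect to
`v ↦ ‖G v‖`. -/
theorem dual_norm_equivalence
    {X Y : Type*}
    [NormedAddCommGroup X] [InnerProductSpace ℝ X]
    [NormedAddCommGroup Y] [InnerProductSpace ℝ Y]
    (G : X →ₗ[ℝ] Y)
    (Xh : Submodule ℝ X) [FiniteDimensional ℝ Xh]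
    (hGinj : ∀ v ∈ Xh, G v = 0 → v = 0)
    (Vh : Submodule ℝ X) (hVX : Vh ≤ Xh)
    (P : Xh →ₗ[ℝ] Vh)
    (hPorth : ∀ (v : Xh) (z : Vh), ⟪((P v : Vh) : X) - (v : X), (z : X)⟫ = 0)
    (CP : ℝ) (hCP : 1 ≤ CP)
    (hPstab : ∀ v : Xh, ‖G ((P v : Vh) : X)‖ ≤ CP * ‖G (v : X)‖) :
    ∀ w ∈ Vh,
      CP⁻¹ * dualNorm G (Xh : Set X) w ≤ dualNorm G (Vh : Set X) w
        ∧ dualNorm G (Vh : Set X) w ≤ dualNorm G (Xh : Set X) w := by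
  intro w hw
  have : FiniteDimensional ℝ Vh := Submodule.finiteDimensional_of_le hVX
  have hV := dualNorm_nonneg (G := G) Vh w
  constructor
  · rw [inv_mul_le_iff₀ (by positivity)]
    refine dualNorm_le (by positivity) fun v hv ↦ ?_
    have hPv : ⟪w, v⟫ = ⟪w, (P ⟨v, hv⟩ : X)⟫ := by
      have h := hPorth ⟨v, hv⟩ ⟨w, hw⟩
      rw [inner_sub_left, sub_eq_zero] at h
      rw [real_inner_comm, ← h, real_inner_comm]
    calc ⟪w, v⟫ = ⟪w, (P ⟨v, hv⟩ : X)⟫ := hPv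
      _ ≤ dualNorm G (Vh : Set X) w * ‖G (P ⟨v, hv⟩ : X)‖ :=
        inner_le_dualNorm_mul (fun u hu ↦ hGinj u (hVX hu)) w (P ⟨v, hv⟩).2
      _ ≤ dualNorm G (Vh : Set X) w * (CP * ‖G v‖) := by
        gcongr
        exact hPstab ⟨v, hv⟩
      _ = CP * dualNorm G (Vh : Set X) w * ‖G v‖ := by ring
  · exact dualNorm_le (dualNorm_nonneg Xh w) fun v hv ↦
      inner_le_dualNorm_mul hGinj w (hVX hv)
end

section
/- In the LIBE framework below, the velocity approximation satisfies, for every N ≥ 1: ‖u^N‖² + Σ_{n=0}^{N−1} ‖u^{n+1} − u^n‖² + ν Δt Σ_{n=0}^{N−1} ‖G u^{n+1}‖² ≤ ν^{-1} Δt Σ_{n=0}^{N−1} F_{n+1}² + ‖u⁰‖². -/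
open scoped RealInnerProductSpace

/-- Polarization identity for a backward difference. -/
theorem two_mul_inner_sub_self_left {X : Type*} [NormedAddCommGroup X] [InnerProductSpace ℝ X]
    (a b : X) : 2 * ⟪a - b, a⟫ = ‖a‖ ^ 2 + ‖a - b‖ ^ 2 - ‖b‖ ^ 2 := by
  rw [norm_sub_sq_real, inner_sub_left, real_inner_self_eq_norm_sq, real_inner_comm a b]
  ring

/-- Young's inequality with weight `ν`. -/
theorem two_mul_mul_le_inv_mul_sq_add_mul_sq {ν : ℝ} (hν : 0 < ν) (x y : ℝ) :
    2 * (x * y) ≤ ν⁻¹ * x ^ 2 + ν * y ^ 2 := by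
  have h : ν⁻¹ * x ^ 2 + ν * y ^ 2 - 2 * (x * y) = ν⁻¹ * (x - ν * y) ^ 2 := by
    field_simp
    ring
  have : 0 ≤ ν⁻¹ * (x - ν * y) ^ 2 := by positivity
  linarith

/-- Theorem 4.1 (abstract form): unconditional energy stability of the velocity approximation
of the linearly implicit Backward Euler scheme. -/
theorem libe_velocity_stability
    {X Y Q : Type*}
    [NormedAddCommGroup X] [InnerProductSpace ℝ X]
    [NormedAddCommGroup Y] [InnerProductSpace ℝ Y]
    [NormedAddCommGroup Q] [NormedSpace ℝ Q]
    (G : X →ₗ[ℝ] Y)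
    (Xh : Submodule ℝ X)
    (Qh : Submodule ℝ Q)
    (d : X →ₗ[ℝ] Q →ₗ[ℝ] ℝ)
    (b : X →ₗ[ℝ] X →ₗ[ℝ] X →ₗ[ℝ] ℝ)
    (hbskew : ∀ u w : X, b u w w = 0)
    (Δt ν : ℝ) (hΔt : 0 < Δt) (hν : 0 < ν)
    (ℓ : ℕ → X →ₗ[ℝ] ℝ) (F : ℕ → ℝ)
    (hℓ : ∀ n, 1 ≤ n → ∀ v : X, |ℓ n v| ≤ F n * ‖G v‖)
    (u : ℕ → X) (p : ℕ → Q)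
    (hu : ∀ n, u n ∈ Xh) (hp : ∀ n, p n ∈ Qh)
    (hscheme : ∀ n : ℕ, ∀ v ∈ Xh,
      ⟪u (n + 1) - u n, v⟫ + Δt * b (u n) (u (n + 1)) v
        + Δt * ν * ⟪G (u (n + 1)), G v⟫ - Δt * d v (p (n + 1)) = Δt * ℓ (n + 1) v)
    (hdiv : ∀ n : ℕ, ∀ q ∈ Qh, d (u (n + 1)) q = 0) :
    ∀ N : ℕ, 1 ≤ N →
      ‖u N‖ ^ 2 + (∑ n ∈ Finset.range N, ‖u (n + 1) - u n‖ ^ 2)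
          + ν * Δt * ∑ n ∈ Finset.range N, ‖G (u (n + 1))‖ ^ 2
        ≤ ν⁻¹ * (Δt * ∑ n ∈ Finset.range N, F (n + 1) ^ 2) + ‖u 0‖ ^ 2 := by
  have step (n : ℕ) : ‖u (n + 1)‖ ^ 2 + ‖u (n + 1) - u n‖ ^ 2 + ν * Δt * ‖G (u (n + 1))‖ ^ 2
      ≤ ν⁻¹ * (Δt * F (n + 1) ^ 2) + ‖u n‖ ^ 2 := by
    have hs := hscheme n (u (n + 1)) (hu (n + 1))
    rw [hbskew, hdiv n _ (hp (n + 1)), real_inner_self_eq_norm_sq] at hs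
    have hpol := two_mul_inner_sub_self_left (u (n + 1)) (u n)
    have hforce := (le_abs_self _).trans (hℓ (n + 1) n.succ_pos (u (n + 1)))
    have hyoung := two_mul_mul_le_inv_mul_sq_add_mul_sq hν (F (n + 1)) ‖G (u (n + 1))‖
    have hbound : 2 * ℓ (n + 1) (u (n + 1))
        ≤ ν⁻¹ * F (n + 1) ^ 2 + ν * ‖G (u (n + 1))‖ ^ 2 := by
      linarith
    have := mul_le_mul_of_nonneg_left hbound hΔt.le
    linarith
  intro N _
  clear * - step
  induction N with
  | zero => simp
  | succ N ih =>
    simp only [Finset.sum_range_succ, mul_add]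
    linarith [step N]
end
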